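/- Define η(x,t) = (15/4)·(−2 + cosh(√(18/5)·(x − 20 − (5/2)t)))·sech⁴(√(9/10)·(x − 20 − (5/2)t)) and u(x,t) = (15/2)·sech²(√(9/10)·(x − 20 − (5/2)t)). Then η and u are smooth on ℝ² and satisfy, at every point (x,t) ∈ ℝ², the abcd Boussinesq system with parameters a = c = 0 and b = d = 1/6, that is, ∂ₜη + ∂ₓu + ∂ₓ(ηu) − (1/6)·∂ₓ²∂ₜη = 0 and ∂ₜu + ∂ₓη + ∂ₓ(u²/2) − (1/6)·∂ₓ²∂ₜu = 0. -/

import Mathlib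

section TravelingWave

variable {f g : ℝ → ℝ} {b c x₀ : ℝ}

/-- The time derivative of a traveling wave. -/
lemma deriv_travelingWave_time (hf : Differentiable ℝ f) (x t : ℝ) :
    deriv (fun s => f (x - x₀ - c * s)) t = -c * deriv f (x - x₀ - c * t) := by
  have h : HasDerivAt (fun s => x - x₀ - c * s) (-c) t := by
    simpa using ((hasDerivAt_id t).const_mul c).const_sub (x - x₀)
  exact ((hf _).hasDerivAt.comp t h).deriv.trans (mul_comm _ _)

/-- The space derivative of a traveling wave. -/
lemma deriv_travelingWave_space (f : ℝ → ℝ) (x t : ℝ) :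
    deriv (fun y => f (y - x₀ - c * t)) x = deriv f (x - x₀ - c * t) := by
  simp only [sub_sub]
  exact deriv_comp_sub_const ..

/-- The mixed third derivative `∂ₓ²∂ₜ` of a traveling wave. -/
lemma iteratedDeriv_two_deriv_travelingWave (hf : ContDiff ℝ (⊤ : ℕ∞) f) (x t : ℝ) :
    iteratedDeriv 2 (fun y => deriv (fun s => f (y - x₀ - c * s)) t) x =
      -c * deriv (deriv (deriv f)) (x - x₀ - c * t) := by
  have hd : Differentiable ℝ f := hf.differentiable (by simp)
  simp only [deriv_travelingWave_time hd, iteratedDeriv_succ, iteratedDeriv_zero,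
    deriv_const_mul_field', deriv_travelingWave_space]

/-- A profile satisfying `-c f + g + h + b c f'' = 0` yields a traveling wave solution of
`∂ₜf + ∂ₓg + ∂ₓh - b ∂ₓ²∂ₜf = 0`. -/
lemma travelingWave_solves {h : ℝ → ℝ} (hf : ContDiff ℝ (⊤ : ℕ∞) f)
    (hg : Differentiable ℝ g) (hh : Differentiable ℝ h)
    (hode : ∀ z, -c * f z + g z + h z + b * c * deriv (deriv f) z = 0) (x t : ℝ) :
    deriv (fun s => f (x - x₀ - c * s)) t + deriv (fun y => g (y - x₀ - c * t)) x +
      deriv (fun y => h (y - x₀ - c * t)) x -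
      b * iteratedDeriv 2 (fun y => deriv (fun s => f (y - x₀ - c * s)) t) x = 0 := by
  have hd : Differentiable ℝ f := hf.differentiable (by simp)
  have hf' : ContDiff ℝ (⊤ : ℕ∞) (deriv f) := (contDiff_infty_iff_deriv.1 hf).2
  have hf'' : Differentiable ℝ (deriv (deriv f)) :=
    (contDiff_infty_iff_deriv.1 hf').2.differentiable (by simp)
  rw [iteratedDeriv_two_deriv_travelingWave hf, deriv_travelingWave_time hd,
    deriv_travelingWave_space g, deriv_travelingWave_space h]
  set z := x - x₀ - c * t
  have key := (((((hd z).hasDerivAt.const_mul (-c)).add (hg z).hasDerivAt).add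
    (hh z).hasDerivAt).add ((hf'' z).hasDerivAt.const_mul (b * c))).unique
    ((hasDerivAt_const z (0 : ℝ)).congr_of_eventuallyEq (.of_forall hode))
  linear_combination key

end TravelingWave

section SechSq

variable {k : ℝ}

/-- The function `z ↦ sech² (k z)`. -/
noncomputable def sechSq (k z : ℝ) : ℝ := (1 / Real.cosh (k * z)) ^ 2

lemma contDiff_sechSq : ContDiff ℝ (⊤ : ℕ∞) (sechSq k) :=
  (contDiff_const.div (Real.contDiff_cosh.comp (contDiff_const.mul contDiff_id))
    fun _ => (Real.cosh_pos _).ne').pow 2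

lemma hasDerivAt_tanh_mul (z : ℝ) :
    HasDerivAt (fun z => Real.tanh (k * z)) (k * sechSq k z) z := by
  have hk : HasDerivAt (fun z => k * z) k z := by simpa using (hasDerivAt_id z).const_mul k
  have hc : Real.cosh (k * z) ≠ 0 := (Real.cosh_pos _).ne'
  simp only [Real.tanh_eq_sinh_div_cosh]
  refine (hk.sinh.div hk.cosh hc).congr_deriv ?_
  rw [sechSq]
  field_simp
  linear_combination k * Real.cosh_sq (k * z)

lemma hasDerivAt_sechSq (z : ℝ) :
    HasDerivAt (sechSq k) (-2 * k * (sechSq k z * Real.tanh (k * z))) z := by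
  have hk : HasDerivAt (fun z => k * z) k z := by simpa using (hasDerivAt_id z).const_mul k
  have hc : Real.cosh (k * z) ≠ 0 := (Real.cosh_pos _).ne'
  refine (((hasDerivAt_const z (1 : ℝ)).div hk.cosh hc).pow 2).congr_deriv ?_
  rw [sechSq, Real.tanh_eq_sinh_div_cosh]
  norm_num [Pi.div_apply]
  field_simp

lemma tanh_sq_mul (z : ℝ) : Real.tanh (k * z) ^ 2 = 1 - sechSq k z := by
  have hc : Real.cosh (k * z) ≠ 0 := (Real.cosh_pos _).ne'
  rw [sechSq, Real.tanh_eq_sinh_div_cosh]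
  field_simp
  linear_combination -Real.cosh_sq (k * z)

/-- The second derivative of a quadratic polynomial in `sech²`. -/
lemma deriv_deriv_quadratic_sechSq (p q z : ℝ) :
    deriv (deriv fun z => p * sechSq k z + q * sechSq k z ^ 2) z =
      k ^ 2 * (p * (4 * sechSq k z - 6 * sechSq k z ^ 2) +
        q * (16 * sechSq k z ^ 2 - 20 * sechSq k z ^ 3)) := by
  have h₁ : (deriv fun z => p * sechSq k z + q * sechSq k z ^ 2) = fun z =>
      p * (-2 * k * (sechSq k z * Real.tanh (k * z))) +
        q * (-4 * k * (sechSq k z ^ 2 * Real.tanh (k * z))) := by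
    funext z
    refine (((hasDerivAt_sechSq z).const_mul p).add
      (((hasDerivAt_sechSq z).pow 2).const_mul q)).deriv.trans ?_
    push_cast
    ring
  rw [h₁]
  have hs := hasDerivAt_sechSq (k := k) z
  have ht := hasDerivAt_tanh_mul (k := k) z
  refine ((((hs.mul ht).const_mul (-2 * k)).const_mul p).add
    ((((hs.pow 2).mul ht).const_mul (-4 * k)).const_mul q)).deriv.trans ?_
  simp only [Pi.pow_apply]
  push_cast
  linear_combination (4 * k ^ 2 * p * sechSq k z + 16 * k ^ 2 * q * sechSq k z ^ 2) *
    tanh_sq_mul (k := k) z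

end SechSq

/-- The traveling-wave pair (η, u) is smooth and solves the
BBM-BBM system (a = c = 0, b = d = 1/6). -/
theorem bbm_bbm_traveling_wave_case3
    (η u : ℝ → ℝ → ℝ)
    (hη : ∀ x t : ℝ, η x t =
      15 / 4 * (-2 + Real.cosh (Real.sqrt (18 / 5) * (x - 20 - 5 / 2 * t))) *
        (1 / Real.cosh (Real.sqrt (9 / 10) * (x - 20 - 5 / 2 * t))) ^ 4)
    (hu : ∀ x t : ℝ, u x t =
      15 / 2 * (1 / Real.cosh (Real.sqrt (9 / 10) * (x - 20 - 5 / 2 * t))) ^ 2) :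
    ContDiff ℝ (⊤ : ℕ∞) (fun p : ℝ × ℝ => η p.1 p.2) ∧
    ContDiff ℝ (⊤ : ℕ∞) (fun p : ℝ × ℝ => u p.1 p.2) ∧
    ∀ x t : ℝ,
      (deriv (fun s => η x s) t + deriv (fun y => u y t) x +
        deriv (fun y => η y t * u y t) x -
        (1 / 6 : ℝ) * iteratedDeriv 2 (fun y => deriv (fun s => η y s) t) x = 0) ∧
      (deriv (fun s => u x s) t + deriv (fun y => η y t) x +
        deriv (fun y => (u y t) ^ 2 / 2) x -
        (1 / 6 : ℝ) * iteratedDeriv 2 (fun y => deriv (fun s => u y s) t) x = 0) := by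
  set k := Real.sqrt (9 / 10)
  have hk : k ^ 2 = 9 / 10 := Real.sq_sqrt (by norm_num)
  have hsqrt : Real.sqrt (18 / 5) = 2 * k := by
    rw [Real.sqrt_eq_iff_mul_self_eq_of_pos (by positivity)]
    linear_combination 4 * hk
  set φ : ℝ → ℝ := fun z => 15 / 2 * sechSq k z + -45 / 4 * sechSq k z ^ 2 with hφ
  set ψ : ℝ → ℝ := fun z => 15 / 2 * sechSq k z + 0 * sechSq k z ^ 2 with hψ
  have hφs : ContDiff ℝ (⊤ : ℕ∞) φ :=
    (contDiff_const.mul contDiff_sechSq).add (contDiff_const.mul (contDiff_sechSq.pow 2))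
  have hψs : ContDiff ℝ (⊤ : ℕ∞) ψ :=
    (contDiff_const.mul contDiff_sechSq).add (contDiff_const.mul (contDiff_sechSq.pow 2))
  obtain rfl : η = fun x t => φ (x - 20 - 5 / 2 * t) := by
    funext x t
    have hc : Real.cosh (k * (x - 20 - 5 / 2 * t)) ≠ 0 := (Real.cosh_pos _).ne'
    simp only [hη, hφ, sechSq, hsqrt, mul_assoc 2 k, Real.cosh_two_mul, Real.sinh_sq]
    field_simp
    ring
  obtain rfl : u = fun x t => ψ (x - 20 - 5 / 2 * t) := by
    funext x t
    simp only [hu, hψ, sechSq]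
    ring
  have hξ : ContDiff ℝ (⊤ : ℕ∞) fun p : ℝ × ℝ => p.1 - 20 - 5 / 2 * p.2 := by fun_prop
  have hφd : Differentiable ℝ φ := hφs.differentiable (by simp)
  have hψd : Differentiable ℝ ψ := hψs.differentiable (by simp)
  refine ⟨hφs.comp hξ, hψs.comp hξ, fun x t => ⟨?_, ?_⟩⟩
  · refine travelingWave_solves (h := fun z => φ z * ψ z) hφs hψd (hφd.mul hψd)
      (fun z => ?_) x t
    rw [hφ, deriv_deriv_quadratic_sechSq, hk]
    simp only [hψ]
    ring
  · refine travelingWave_solves (h := fun z => ψ z ^ 2 / 2) hψs hφd ((hψd.pow 2).div_const 2)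
      (fun z => ?_) x t
    rw [hψ, deriv_deriv_quadratic_sechSq, hk]
    simp only [hφ]
    ring
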